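/- arXiv:1903.06510 — 8 statements merged into one kernel-verified Lean document; each statement's English description precedes it below -/
import Mathlib

section
/- Let T ∈ (0,∞], let a, b : (0,T) → ℝ with a continuously differentiable and b continuous, and let v₁, v₂ : (0,T) → ℝ be twice differentiable functions satisfying vⱼ'' + a·vⱼ' + b·vⱼ = 0 on (0,T) for j = 1,2. Let I ⊆ (0,T) be an open set on which v₁² + v₂² ≠ 0 and on which the Wronskian v₁'·v₂ − v₁·v₂' does not vanish. Define ω : I → ℝ by ω := (v₁'·v₂ − v₁·v₂')/(v₁² + v₂²). Then ω is differentiable and nonvanishing on I, the function ω'/(2ω) is differentiable on I, and the frequency-function identity ω² − (ω'/(2ω))² + (ω'/(2ω))' = b − (a/2)² − a'/2 holds on I. -/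
/-- For twice differentiable solutions `v₁, v₂` of `v'' + a v' + b v = 0`
on `(0,T)` (with `a` continuously differentiable and `b` continuous), on any open set
`I ⊆ (0,T)` where `v₁² + v₂² ≠ 0` and the Wronskian does not vanish, the function
`ω := (v₁'·v₂ − v₁·v₂')/(v₁² + v₂²)` is differentiable and nonvanishing, `ω'/(2ω)` is
differentiable, and the frequency-function identity
`ω² − (ω'/(2ω))² + (ω'/(2ω))' = b − (a/2)² − a'/2` holds on `I`. -/
theorem stmt_0 (T : EReal) (hT : 0 < T)
    (a b v₁ v₂ : ℝ → ℝ)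
    (ha : ∀ t : ℝ, 0 < t → (t : EReal) < T → DifferentiableAt ℝ a t)
    (ha' : ContinuousOn (deriv a) {t : ℝ | 0 < t ∧ (t : EReal) < T})
    (hb : ContinuousOn b {t : ℝ | 0 < t ∧ (t : EReal) < T})
    (hv₁ : ∀ t : ℝ, 0 < t → (t : EReal) < T →
      DifferentiableAt ℝ v₁ t ∧ DifferentiableAt ℝ (deriv v₁) t)
    (hv₂ : ∀ t : ℝ, 0 < t → (t : EReal) < T →
      DifferentiableAt ℝ v₂ t ∧ DifferentiableAt ℝ (deriv v₂) t)
    (hode₁ : ∀ t : ℝ, 0 < t → (t : EReal) < T →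
      deriv (deriv v₁) t + a t * deriv v₁ t + b t * v₁ t = 0)
    (hode₂ : ∀ t : ℝ, 0 < t → (t : EReal) < T →
      deriv (deriv v₂) t + a t * deriv v₂ t + b t * v₂ t = 0)
    (I : Set ℝ) (hIopen : IsOpen I)
    (hIsub : I ⊆ {t : ℝ | 0 < t ∧ (t : EReal) < T})
    (hne : ∀ t ∈ I, v₁ t ^ 2 + v₂ t ^ 2 ≠ 0)
    (hW : ∀ t ∈ I, deriv v₁ t * v₂ t - v₁ t * deriv v₂ t ≠ 0)
    (ω : ℝ → ℝ)
    (hω : ∀ t ∈ I,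
      ω t = (deriv v₁ t * v₂ t - v₁ t * deriv v₂ t) / (v₁ t ^ 2 + v₂ t ^ 2)) :
    ∀ t ∈ I,
      DifferentiableAt ℝ ω t ∧ ω t ≠ 0 ∧
      DifferentiableAt ℝ (fun s => deriv ω s / (2 * ω s)) t ∧
      ω t ^ 2 - (deriv ω t / (2 * ω t)) ^ 2
          + deriv (fun s => deriv ω s / (2 * ω s)) t
        = b t - (a t / 2) ^ 2 - deriv a t / 2 := by
  have hω' : ∀ t ∈ I, HasDerivAt ω
      (2 * ω t * (-(a t / 2) -
        (v₁ t * deriv v₁ t + v₂ t * deriv v₂ t) / (v₁ t ^ 2 + v₂ t ^ 2))) t := by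
    intro t ht
    obtain ⟨h0, hT'⟩ := hIsub ht
    have d₁ := (hv₁ t h0 hT').1.hasDerivAt
    have e₁ := (hv₁ t h0 hT').2.hasDerivAt
    have d₂ := (hv₂ t h0 hT').1.hasDerivAt
    have e₂ := (hv₂ t h0 hT').2.hasDerivAt
    have o₁ : deriv (deriv v₁) t = -(a t * deriv v₁ t) - b t * v₁ t := by
      linear_combination hode₁ t h0 hT'
    have o₂ : deriv (deriv v₂) t = -(a t * deriv v₂ t) - b t * v₂ t := by
      linear_combination hode₂ t h0 hT'
    have hn := hne t ht
    have key := ((e₁.mul d₂).sub (d₁.mul e₂)).div ((d₁.pow 2).add (d₂.pow 2)) hn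
    refine (key.congr_of_eventuallyEq
      (Filter.eventuallyEq_of_mem (hIopen.mem_nhds ht) hω)).congr_deriv ?_
    simp only [Pi.add_apply, Pi.sub_apply, Pi.mul_apply, Pi.pow_apply]
    rw [hω t ht, o₁, o₂]
    field_simp
    push_cast
    ring
  have hω0 : ∀ t ∈ I, ω t ≠ 0 := fun t ht => by
    rw [hω t ht]
    exact div_ne_zero (hW t ht) (hne t ht)
  have hg : ∀ t ∈ I, deriv ω t / (2 * ω t) = -(a t / 2) -
      (v₁ t * deriv v₁ t + v₂ t * deriv v₂ t) / (v₁ t ^ 2 + v₂ t ^ 2) := fun t ht => by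
    rw [(hω' t ht).deriv]
    exact mul_div_cancel_left₀ _ (mul_ne_zero two_ne_zero (hω0 t ht))
  intro t ht
  obtain ⟨h0, hT'⟩ := hIsub ht
  have d₁ := (hv₁ t h0 hT').1.hasDerivAt
  have e₁ := (hv₁ t h0 hT').2.hasDerivAt
  have d₂ := (hv₂ t h0 hT').1.hasDerivAt
  have e₂ := (hv₂ t h0 hT').2.hasDerivAt
  have o₁ : deriv (deriv v₁) t = -(a t * deriv v₁ t) - b t * v₁ t := by
    linear_combination hode₁ t h0 hT'
  have o₂ : deriv (deriv v₂) t = -(a t * deriv v₂ t) - b t * v₂ t := by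
    linear_combination hode₂ t h0 hT'
  have hn := hne t ht
  have key := (((ha t h0 hT').hasDerivAt.div_const 2).neg.sub
    (((d₁.mul e₁).add (d₂.mul e₂)).div ((d₁.pow 2).add (d₂.pow 2)) hn)).congr_of_eventuallyEq
      (Filter.eventuallyEq_of_mem (hIopen.mem_nhds ht) hg)
  refine ⟨(hω' t ht).differentiableAt, hω0 t ht, key.differentiableAt, ?_⟩
  rw [key.deriv, hg t ht, hω t ht]
  simp only [Pi.add_apply, Pi.mul_apply, Pi.pow_apply]
  rw [o₁, o₂]
  field_simp
  push_cast
  ring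
end

section
/- Let T ∈ (0,∞], let a, b : (0,T) → ℝ with a continuously differentiable and b continuous, and let v₁, v₂ : (0,T) → ℝ be twice differentiable functions satisfying vⱼ'' + a·vⱼ' + b·vⱼ = 0 on (0,T) for j = 1,2. Let I ⊆ (0,T) be an open set on which v₂² − v₁² ≠ 0 and on which the Wronskian v₁'·v₂ − v₁·v₂' does not vanish. Define ε : I → ℝ by ε := (v₁'·v₂ − v₁·v₂')/(v₂² − v₁²). Then ε is differentiable and nonvanishing on I, the function ε'/(2ε) is differentiable on I, and the identity −ε² − (ε'/(2ε))² + (ε'/(2ε))' = b − (a/2)² − a'/2 holds on I (i.e., the purely imaginary function ω = i·ε satisfies the frequency-function identity). -/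
/-- For twice differentiable solutions `v₁, v₂` of `v'' + a v' + b v = 0`
on `(0,T)` (with `a` continuously differentiable and `b` continuous), on any open set
`I ⊆ (0,T)` where `v₂² − v₁² ≠ 0` and the Wronskian does not vanish, the function
`ε := (v₁'·v₂ − v₁·v₂')/(v₂² − v₁²)` is differentiable and nonvanishing, `ε'/(2ε)` is
differentiable, and `−ε² − (ε'/(2ε))² + (ε'/(2ε))' = b − (a/2)² − a'/2` holds on `I`. -/
theorem stmt_1 (T : EReal) (hT : 0 < T)
    (a b v₁ v₂ : ℝ → ℝ)
    (ha : ∀ t : ℝ, 0 < t → (t : EReal) < T → DifferentiableAt ℝ a t)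
    (ha' : ContinuousOn (deriv a) {t : ℝ | 0 < t ∧ (t : EReal) < T})
    (hb : ContinuousOn b {t : ℝ | 0 < t ∧ (t : EReal) < T})
    (hv₁ : ∀ t : ℝ, 0 < t → (t : EReal) < T →
      DifferentiableAt ℝ v₁ t ∧ DifferentiableAt ℝ (deriv v₁) t)
    (hv₂ : ∀ t : ℝ, 0 < t → (t : EReal) < T →
      DifferentiableAt ℝ v₂ t ∧ DifferentiableAt ℝ (deriv v₂) t)
    (hode₁ : ∀ t : ℝ, 0 < t → (t : EReal) < T →
      deriv (deriv v₁) t + a t * deriv v₁ t + b t * v₁ t = 0)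
    (hode₂ : ∀ t : ℝ, 0 < t → (t : EReal) < T →
      deriv (deriv v₂) t + a t * deriv v₂ t + b t * v₂ t = 0)
    (I : Set ℝ) (hIopen : IsOpen I)
    (hIsub : I ⊆ {t : ℝ | 0 < t ∧ (t : EReal) < T})
    (hne : ∀ t ∈ I, v₂ t ^ 2 - v₁ t ^ 2 ≠ 0)
    (hW : ∀ t ∈ I, deriv v₁ t * v₂ t - v₁ t * deriv v₂ t ≠ 0)
    (ε : ℝ → ℝ)
    (hε : ∀ t ∈ I,
      ε t = (deriv v₁ t * v₂ t - v₁ t * deriv v₂ t) / (v₂ t ^ 2 - v₁ t ^ 2)) :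
    ∀ t ∈ I,
      DifferentiableAt ℝ ε t ∧ ε t ≠ 0 ∧
      DifferentiableAt ℝ (fun s => deriv ε s / (2 * ε s)) t ∧
      -(ε t ^ 2) - (deriv ε t / (2 * ε t)) ^ 2
          + deriv (fun s => deriv ε s / (2 * ε s)) t
        = b t - (a t / 2) ^ 2 - deriv a t / 2 := by
  have hd : ∀ t ∈ I,
      HasDerivAt ε ((-a t - 2 * (v₂ t * deriv v₂ t - v₁ t * deriv v₁ t) /
        (v₂ t ^ 2 - v₁ t ^ 2)) * ε t) t := by
    intro t ht
    obtain ⟨h0, h1⟩ := hIsub ht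
    have d1 := (hv₁ t h0 h1).1.hasDerivAt
    have d1' := (hv₁ t h0 h1).2.hasDerivAt
    have d2 := (hv₂ t h0 h1).1.hasDerivAt
    have d2' := (hv₂ t h0 h1).2.hasDerivAt
    have e1 := hode₁ t h0 h1
    have e2 := hode₂ t h0 h1
    have hD := hne t ht
    have h := ((d1'.mul d2).sub (d1.mul d2')).div ((d2.pow 2).sub (d1.pow 2)) hD
    have hloc : ε =ᶠ[nhds t] fun s =>
        (deriv v₁ s * v₂ s - v₁ s * deriv v₂ s) / (v₂ s ^ 2 - v₁ s ^ 2) :=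
      Filter.eventuallyEq_of_mem (hIopen.mem_nhds ht) hε
    refine (HasDerivAt.congr_of_eventuallyEq h hloc).congr_deriv ?_
    rw [hε t ht]
    simp only [Pi.sub_apply, Pi.mul_apply, Pi.pow_apply]
    field_simp
    push_cast
    linear_combination (v₂ t ^ 2 - v₁ t ^ 2) * (v₂ t * e1 - v₁ t * e2)
  have hε0 : ∀ t ∈ I, ε t ≠ 0 := fun t ht => by
    rw [hε t ht]
    exact div_ne_zero (hW t ht) (hne t ht)
  have hq : ∀ t ∈ I, deriv ε t / (2 * ε t) =
      -(a t / 2) - (v₂ t * deriv v₂ t - v₁ t * deriv v₁ t) / (v₂ t ^ 2 - v₁ t ^ 2) := by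
    intro t ht
    have h0 := hε0 t ht
    have hD := hne t ht
    rw [(hd t ht).deriv]
    field_simp
  intro t ht
  obtain ⟨h0, h1⟩ := hIsub ht
  have d1 := (hv₁ t h0 h1).1.hasDerivAt
  have d1' := (hv₁ t h0 h1).2.hasDerivAt
  have d2 := (hv₂ t h0 h1).1.hasDerivAt
  have d2' := (hv₂ t h0 h1).2.hasDerivAt
  have hD := hne t ht
  have h := ((ha t h0 h1).hasDerivAt.div_const 2).neg.sub
    (((d2.mul d2').sub (d1.mul d1')).div ((d2.pow 2).sub (d1.pow 2)) hD)
  have hloc : (fun s => deriv ε s / (2 * ε s)) =ᶠ[nhds t] fun s =>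
      -(a s / 2) - (v₂ s * deriv v₂ s - v₁ s * deriv v₁ s) / (v₂ s ^ 2 - v₁ s ^ 2) :=
    Filter.eventuallyEq_of_mem (hIopen.mem_nhds ht) hq
  have hq' := HasDerivAt.congr_of_eventuallyEq h hloc
  refine ⟨(hd t ht).differentiableAt, hε0 t ht, hq'.differentiableAt, ?_⟩
  rw [hq'.deriv, hq t ht, hε t ht,
    show deriv (deriv v₁) t = -a t * deriv v₁ t - b t * v₁ t by
      linear_combination hode₁ t h0 h1,
    show deriv (deriv v₂) t = -a t * deriv v₂ t - b t * v₂ t by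
      linear_combination hode₂ t h0 h1]
  simp only [Pi.sub_apply, Pi.mul_apply, Pi.pow_apply]
  field_simp
  push_cast
  ring
end

section
/- Let T ∈ (0,∞], let a : [0,T) → ℝ be continuously differentiable, b : [0,T) → ℝ be continuous, and let ω : [0,T) → ℝ be twice continuously differentiable with ω(t) > 0 for all t, satisfying the frequency-function identity ω² − (ω'/(2ω))² + (ω'/(2ω))' = b − (a/2)² − a'/2 on (0,T). Let α := a/2 + ω'/(2ω), and let f₀ : [0,T) → ℝ be continuous with f₀ vanishing on a neighborhood of 0. Define v(t) := ∫₀ᵗ f₀(s)·(1/ω(s))·sin(∫ₛᵗ ω(r) dr)·exp(−∫ₛᵗ α(r) dr) ds for t ∈ [0,T). Then v is twice differentiable, v'' + a·v' + b·v = f₀ on (0,T), and v(0) = 0, v'(0) = 0. -/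
/-- The primitive of a continuous function on `[0, c]` is differentiable on `(0, c)`. -/
lemma hasDerivAt_primitive_of_continuousOn_Icc {g : ℝ → ℝ} {c : ℝ}
    (hg : ContinuousOn g (Set.Icc 0 c)) {t : ℝ} (ht : t ∈ Set.Ioo 0 c) :
    HasDerivAt (fun x => ∫ s in (0:ℝ)..x, g s) (g t) t := by
  apply intervalIntegral.integral_hasDerivAt_right
  · apply ContinuousOn.intervalIntegrable
    rw [Set.uIcc_of_le ht.1.le]
    exact hg.mono (Set.Icc_subset_Icc_right ht.2.le)
  · exact (hg.mono Set.Ioo_subset_Icc_self).stronglyMeasurableAtFilter isOpen_Ioo t ht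
  · exact hg.continuousAt (Icc_mem_nhds ht.1 ht.2)

lemma continuousOn_primitive_Icc {g : ℝ → ℝ} {c : ℝ} (hc : 0 ≤ c)
    (hg : ContinuousOn g (Set.Icc 0 c)) :
    ContinuousOn (fun x => ∫ s in (0:ℝ)..x, g s) (Set.Icc 0 c) := by
  have h := intervalIntegral.continuousOn_primitive_interval (a := 0) (b := c)
    (f := g) (μ := MeasureTheory.volume)
  rw [Set.uIcc_of_le hc] at h
  exact h hg.integrableOn_Icc

lemma intervalIntegral_eq_primitive_sub {g : ℝ → ℝ} {c : ℝ}
    (hg : ContinuousOn g (Set.Icc 0 c)) {s t : ℝ} (hs : s ∈ Set.Icc 0 c)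
    (ht : t ∈ Set.Icc 0 c) :
    ∫ r in s..t, g r = (∫ r in (0:ℝ)..t, g r) - ∫ r in (0:ℝ)..s, g r := by
  have key : ∀ x ∈ Set.Icc 0 c, IntervalIntegrable g MeasureTheory.volume 0 x := by
    intro x hx
    apply ContinuousOn.intervalIntegrable
    rw [Set.uIcc_of_le hx.1]
    exact hg.mono (Set.Icc_subset_Icc_right hx.2)
  rw [intervalIntegral.integral_interval_sub_left (key t ht) (key s hs)]

/-- The Duhamel integral `v`, together with its cosine companion `u`, solves the first-order
system `v' = -α v + ω u`, `u' = -α u - ω v + f / ω`. -/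
lemma exists_companion_hasDerivAt_duhamel {c : ℝ} {f ω α : ℝ → ℝ}
    (hf : ContinuousOn f (Set.Icc 0 c)) (hω : ContinuousOn ω (Set.Icc 0 c))
    (hα : ContinuousOn α (Set.Icc 0 c)) (hω0 : ∀ t ∈ Set.Icc 0 c, ω t ≠ 0)
    {v : ℝ → ℝ}
    (hv : v = fun t => ∫ s in (0:ℝ)..t,
      f s * (1 / ω s) * Real.sin (∫ r in s..t, ω r) * Real.exp (-(∫ r in s..t, α r))) :
    ∃ u : ℝ → ℝ, ∀ t ∈ Set.Ioo 0 c,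
      HasDerivAt v (-α t * v t + ω t * u t) t ∧
      HasDerivAt u (-α t * u t - ω t * v t + f t / ω t) t := by
  rcases lt_or_ge c 0 with hc | hc
  · exact ⟨0, fun t ht => absurd (ht.1.trans ht.2) hc.le.not_gt⟩
  set W : ℝ → ℝ := fun t => ∫ r in (0:ℝ)..t, ω r with hW
  set A : ℝ → ℝ := fun t => ∫ r in (0:ℝ)..t, α r with hA
  have hWc : ContinuousOn W (Set.Icc 0 c) := continuousOn_primitive_Icc hc hω
  have hAc : ContinuousOn A (Set.Icc 0 c) := continuousOn_primitive_Icc hc hα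
  set p : ℝ → ℝ := fun s => f s * (1 / ω s) * Real.cos (W s) * Real.exp (A s) with hp
  set q : ℝ → ℝ := fun s => f s * (1 / ω s) * Real.sin (W s) * Real.exp (A s) with hq
  have hfω : ContinuousOn (fun s => f s * (1 / ω s)) (Set.Icc 0 c) :=
    hf.mul (continuousOn_const.div hω hω0)
  have hpc : ContinuousOn p (Set.Icc 0 c) :=
    (hfω.mul (Real.continuous_cos.comp_continuousOn hWc)).mul
      (Real.continuous_exp.comp_continuousOn hAc)
  have hqc : ContinuousOn q (Set.Icc 0 c) :=
    (hfω.mul (Real.continuous_sin.comp_continuousOn hWc)).mul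
      (Real.continuous_exp.comp_continuousOn hAc)
  set P : ℝ → ℝ := fun t => ∫ s in (0:ℝ)..t, p s with hP
  set Q : ℝ → ℝ := fun t => ∫ s in (0:ℝ)..t, q s with hQ
  have hv_eq : ∀ t ∈ Set.Ioo 0 c,
      v t = Real.exp (-A t) * (Real.sin (W t) * P t - Real.cos (W t) * Q t) := by
    intro t ht
    have hint : ∀ g : ℝ → ℝ, ContinuousOn g (Set.Icc 0 c) →
        IntervalIntegrable g MeasureTheory.volume 0 t := by
      intro g hg
      apply ContinuousOn.intervalIntegrable
      rw [Set.uIcc_of_le ht.1.le]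
      exact hg.mono (Set.Icc_subset_Icc_right ht.2.le)
    rw [hP, hQ]
    simp only
    rw [← intervalIntegral.integral_const_mul, ← intervalIntegral.integral_const_mul,
      ← intervalIntegral.integral_sub ((hint p hpc).const_mul _) ((hint q hqc).const_mul _),
      ← intervalIntegral.integral_const_mul, hv]
    apply intervalIntegral.integral_congr
    intro s hs
    rw [Set.uIcc_of_le ht.1.le] at hs
    have hs' : s ∈ Set.Icc 0 c := ⟨hs.1, hs.2.trans ht.2.le⟩
    have ht' : t ∈ Set.Icc 0 c := Set.Ioo_subset_Icc_self ht
    simp only [hp, hq]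
    rw [intervalIntegral_eq_primitive_sub hω hs' ht', intervalIntegral_eq_primitive_sub hα hs' ht']
    change f s * (1 / ω s) * Real.sin (W t - W s) * Real.exp (-(A t - A s)) = _
    rw [Real.sin_sub, show -(A t - A s) = -A t + A s by ring, Real.exp_add]
    ring
  refine ⟨fun t => Real.exp (-A t) * (Real.cos (W t) * P t + Real.sin (W t) * Q t),
    fun t ht => ?_⟩
  have dW : HasDerivAt W (ω t) t := hasDerivAt_primitive_of_continuousOn_Icc hω ht
  have dA : HasDerivAt A (α t) t := hasDerivAt_primitive_of_continuousOn_Icc hα ht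
  have dP : HasDerivAt P (p t) t := hasDerivAt_primitive_of_continuousOn_Icc hpc ht
  have dQ : HasDerivAt Q (q t) t := hasDerivAt_primitive_of_continuousOn_Icc hqc ht
  have hexp : Real.exp (-A t) * Real.exp (A t) = 1 := by rw [← Real.exp_add]; simp
  constructor
  · have h := dA.neg.exp.mul ((dW.sin.mul dP).sub (dW.cos.mul dQ))
    refine (h.congr_of_eventuallyEq ?_).congr_deriv ?_
    · filter_upwards [isOpen_Ioo.mem_nhds ht] with x hx
      exact hv_eq x hx
    · rw [hv_eq t ht]
      simp [hp, hq]
      ring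
  · have h := dA.neg.exp.mul ((dW.cos.mul dP).add (dW.sin.mul dQ))
    refine h.congr_deriv ?_
    rw [hv_eq t ht]
    simp [hp, hq]
    linear_combination (f t / ω t) * (Real.exp (-A t) * Real.exp (A t)) *
      Real.sin_sq_add_cos_sq (W t) + (f t / ω t) * hexp

lemma duhamel_eventuallyEq_zero {f : ℝ → ℝ} (hf : ∀ᶠ t in nhds (0 : ℝ), f t = 0)
    (K : ℝ → ℝ → ℝ) :
    (fun t => ∫ s in (0:ℝ)..t, f s * K s t) =ᶠ[nhds 0] 0 := by
  obtain ⟨ε, hε, h⟩ := Metric.eventually_nhds_iff_ball.1 hf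
  filter_upwards [Metric.ball_mem_nhds (0 : ℝ) hε] with t ht
  refine (intervalIntegral.integral_congr (g := fun _ => (0 : ℝ)) fun s hs => ?_).trans (by simp)
  have hs' : s ∈ Metric.ball (0 : ℝ) ε :=
    ((convex_ball (0 : ℝ) ε).ordConnected.uIcc_subset (Metric.mem_ball_self hε) ht) hs
  simp [h s hs']

/-- Duhamel-type representation formula: if `ω > 0` is twice continuously
differentiable on `[0,T)` and satisfies the frequency-function identity, with
`α := a/2 + ω'/(2ω)`, and `f₀` is continuous and vanishes near `0`, then
`v(t) := ∫₀ᵗ f₀(s)·(1/ω(s))·sin(∫ₛᵗ ω)·exp(−∫ₛᵗ α) ds` is twice differentiable,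
solves `v'' + a v' + b v = f₀` on `(0,T)`, and `v(0) = 0`, `v'(0) = 0`. -/
theorem stmt_5 (T : EReal) (hT : 0 < T)
    (a b ω : ℝ → ℝ)
    (ha1 : ∀ t : ℝ, 0 ≤ t → (t : EReal) < T → DifferentiableAt ℝ a t)
    (ha2 : ContinuousOn (deriv a) {t : ℝ | 0 ≤ t ∧ (t : EReal) < T})
    (hbc : ContinuousOn b {t : ℝ | 0 ≤ t ∧ (t : EReal) < T})
    (hωpos : ∀ t : ℝ, 0 ≤ t → (t : EReal) < T → 0 < ω t)
    (hω1 : ∀ t : ℝ, 0 ≤ t → (t : EReal) < T → DifferentiableAt ℝ ω t)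
    (hω2 : ∀ t : ℝ, 0 ≤ t → (t : EReal) < T → DifferentiableAt ℝ (deriv ω) t)
    (hω2c : ContinuousOn (deriv (deriv ω)) {t : ℝ | 0 ≤ t ∧ (t : EReal) < T})
    (hfreq : ∀ t : ℝ, 0 < t → (t : EReal) < T →
      ω t ^ 2 - (deriv ω t / (2 * ω t)) ^ 2 + deriv (fun s => deriv ω s / (2 * ω s)) t
        = b t - (a t / 2) ^ 2 - deriv a t / 2)
    (α : ℝ → ℝ) (hα : α = fun t => a t / 2 + deriv ω t / (2 * ω t))
    (f₀ : ℝ → ℝ)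
    (hf₀c : ContinuousOn f₀ {t : ℝ | 0 ≤ t ∧ (t : EReal) < T})
    (hf₀0 : ∀ᶠ t in nhds (0 : ℝ), f₀ t = 0)
    (v : ℝ → ℝ)
    (hv : v = fun t => ∫ s in (0:ℝ)..t,
        f₀ s * (1 / ω s) * Real.sin (∫ r in s..t, ω r) * Real.exp (-(∫ r in s..t, α r))) :
    (∀ t : ℝ, 0 ≤ t → (t : EReal) < T →
        DifferentiableAt ℝ v t ∧ DifferentiableAt ℝ (deriv v) t) ∧
    (∀ t : ℝ, 0 < t → (t : EReal) < T →
        deriv (deriv v) t + a t * deriv v t + b t * v t = f₀ t) ∧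
    v 0 = 0 ∧ deriv v 0 = 0 := by
  have hv0 : v =ᶠ[nhds 0] 0 := by
    rw [hv]
    simpa only [mul_assoc] using duhamel_eventuallyEq_zero hf₀0 (fun s t =>
      1 / ω s * (Real.sin (∫ r in s..t, ω r) * Real.exp (-(∫ r in s..t, α r))))
  have hdv0 : deriv v =ᶠ[nhds 0] 0 := by
    have h := hv0.deriv
    rwa [deriv_zero] at h
  have main : ∀ t : ℝ, 0 < t → (t : EReal) < T →
      DifferentiableAt ℝ v t ∧ DifferentiableAt ℝ (deriv v) t ∧
      deriv (deriv v) t + a t * deriv v t + b t * v t = f₀ t := by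
    intro t ht htT
    obtain ⟨c, htc, hcT⟩ := EReal.lt_iff_exists_real_btwn.1 htT
    rw [EReal.coe_lt_coe_iff] at htc
    have hsub : Set.Icc 0 c ⊆ {t : ℝ | 0 ≤ t ∧ (t : EReal) < T} := fun x hx =>
      ⟨hx.1, (EReal.coe_le_coe_iff.2 hx.2).trans_lt hcT⟩
    have hω0 : ∀ x ∈ Set.Icc 0 c, ω x ≠ 0 := fun x hx => (hωpos x (hsub hx).1 (hsub hx).2).ne'
    have hωc : ContinuousOn ω (Set.Icc 0 c) := fun x hx =>
      (hω1 x (hsub hx).1 (hsub hx).2).continuousAt.continuousWithinAt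
    have hαd : ∀ x ∈ Set.Icc 0 c, DifferentiableAt ℝ (fun s => deriv ω s / (2 * ω s)) x :=
      fun x hx => (hω2 x (hsub hx).1 (hsub hx).2).div
        ((hω1 x (hsub hx).1 (hsub hx).2).const_mul 2) (mul_ne_zero two_ne_zero (hω0 x hx))
    have hαD : ∀ x ∈ Set.Icc 0 c,
        HasDerivAt α (deriv a x / 2 + deriv (fun s => deriv ω s / (2 * ω s)) x) x := by
      intro x hx
      rw [hα]
      exact ((ha1 x (hsub hx).1 (hsub hx).2).hasDerivAt.div_const 2).add (hαd x hx).hasDerivAt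
    have hαc : ContinuousOn α (Set.Icc 0 c) := fun x hx =>
      (hαD x hx).continuousAt.continuousWithinAt
    obtain ⟨u, hu⟩ := exists_companion_hasDerivAt_duhamel (hf₀c.mono hsub) hωc hαc hω0 hv
    have htI : t ∈ Set.Ioo 0 c := ⟨ht, htc⟩
    have htI' : t ∈ Set.Icc 0 c := Set.Ioo_subset_Icc_self htI
    obtain ⟨dv, du⟩ := hu t htI
    have heq : deriv v =ᶠ[nhds t] fun x => -α x * v x + ω x * u x := by
      filter_upwards [isOpen_Ioo.mem_nhds htI] with x hx
      exact (hu x hx).1.deriv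
    have ddv := (((hαD t htI').neg.mul dv).add
      ((hω1 t ht.le htT).hasDerivAt.mul du)).congr_of_eventuallyEq heq
    refine ⟨dv.differentiableAt, ddv.differentiableAt, ?_⟩
    rw [ddv.deriv, dv.deriv]
    have hfr := hfreq t ht htT
    have hαt : α t = a t / 2 + deriv ω t / (2 * ω t) := by rw [hα]
    have hωt := hω0 t htI'
    generalize deriv (fun s => deriv ω s / (2 * ω s)) t = β at hfr ⊢
    obtain ⟨γ, hγ⟩ : ∃ γ, γ = deriv ω t / (2 * ω t) := ⟨_, rfl⟩
    have hω' : deriv ω t = 2 * ω t * γ := by rw [hγ]; field_simp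
    rw [← hγ] at hαt hfr
    have hdiv : ω t * (f₀ t / ω t) = f₀ t := by field_simp
    simp only [Pi.neg_apply, hαt, hω']
    linear_combination hdiv - v t * hfr
  refine ⟨fun t ht htT => ?_, fun t ht htT => (main t ht htT).2.2, hv0.eq_of_nhds,
    hdv0.eq_of_nhds⟩
  rcases ht.eq_or_lt with rfl | ht
  · exact ⟨(differentiableAt_const (0 : ℝ)).congr_of_eventuallyEq hv0,
      (differentiableAt_const (0 : ℝ)).congr_of_eventuallyEq hdv0⟩
  · exact ⟨(main t ht htT).1, (main t ht htT).2.1⟩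
end

section
/- Let T, a₀, b₀ > 0 and a₁ ∈ ℝ with b₀ > (a₀/2 + 1/(2T))², and set ω₀ := √(b₀ − (a₀/2 + 1/(2T))²). Define on [0,T): a(t) := a₀·T/(T−t) − (a₁/T)·t, ω(t) := ω₀·T/(T−t), and b(t) := b₀·T²/(T−t)² + a₁²·t²/(4T²) − a₁·a₀·t/(2(T−t)) − a₁/(2T). Then ω is positive, twice continuously differentiable, and satisfies the frequency-function identity ω² − (ω'/(2ω))² + (ω'/(2ω))' = b − (a/2)² − a'/2 on (0,T). -/
lemma hasDerivAt_div_const_sub_pow (c T : ℝ) (n : ℕ) {s : ℝ} (hs : s ≠ T) :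
    HasDerivAt (fun t => c / (T - t) ^ n) (n * c / (T - s) ^ (n + 1)) s := by
  have h : T - s ≠ 0 := sub_ne_zero.mpr hs.symm
  have h1 : HasDerivAt (fun t => T - t) (-1) s := (hasDerivAt_id s).const_sub T
  refine (((h1.fun_pow n).fun_inv (pow_ne_zero n h)).const_mul c).congr_deriv ?_
  rcases n with _ | n
  · simp
  · simp only [Nat.add_sub_cancel]
    field_simp
    ring

lemma hasDerivAt_div_const_sub (c T : ℝ) {s : ℝ} (hs : s ≠ T) :
    HasDerivAt (fun t => c / (T - t)) (c / (T - s) ^ 2) s := by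
  simpa using hasDerivAt_div_const_sub_pow c T 1 hs

/-- With `a(t) := a₀T/(T−t) − (a₁/T)t`, `ω(t) := ω₀T/(T−t)` where
`ω₀ := √(b₀ − (a₀/2 + 1/(2T))²)`, and the explicit `b` below, the function `ω` is
positive and twice continuously differentiable on `[0,T)` and satisfies the
frequency-function identity `ω² − (ω'/(2ω))² + (ω'/(2ω))' = b − (a/2)² − a'/2`
on `(0,T)`. -/
theorem stmt_8 (T a₀ b₀ a₁ : ℝ) (hT : 0 < T) (ha₀ : 0 < a₀) (hb₀ : 0 < b₀)
    (hb₀big : (a₀ / 2 + 1 / (2 * T)) ^ 2 < b₀)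
    (ω₀ : ℝ) (hω₀ : ω₀ = Real.sqrt (b₀ - (a₀ / 2 + 1 / (2 * T)) ^ 2))
    (a b ω : ℝ → ℝ)
    (ha : a = fun t => a₀ * T / (T - t) - a₁ / T * t)
    (hω : ω = fun t => ω₀ * T / (T - t))
    (hbdef : b = fun t => b₀ * T ^ 2 / (T - t) ^ 2 + a₁ ^ 2 * t ^ 2 / (4 * T ^ 2)
        - a₁ * a₀ * t / (2 * (T - t)) - a₁ / (2 * T)) :
    (∀ t ∈ Set.Ico (0 : ℝ) T, 0 < ω t) ∧
    (∀ t ∈ Set.Ico (0 : ℝ) T, DifferentiableAt ℝ ω t ∧ DifferentiableAt ℝ (deriv ω) t) ∧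
    ContinuousOn (deriv (deriv ω)) (Set.Ico (0 : ℝ) T) ∧
    (∀ t ∈ Set.Ioo (0 : ℝ) T,
      ω t ^ 2 - (deriv ω t / (2 * ω t)) ^ 2 + deriv (fun s => deriv ω s / (2 * ω s)) t
        = b t - (a t / 2) ^ 2 - deriv a t / 2) := by
  have hpos : 0 < ω₀ := hω₀ ▸ Real.sqrt_pos.mpr (sub_pos.mpr hb₀big)
  have hsq : ω₀ ^ 2 = b₀ - (a₀ / 2 + 1 / (2 * T)) ^ 2 :=
    hω₀ ▸ Real.sq_sqrt (sub_pos.mpr hb₀big).le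
  have hωt : ∀ s, ω s = ω₀ * T / (T - s) := fun s => by rw [hω]
  have hev : ∀ {t}, t ≠ T → ∀ᶠ s in nhds t, s ≠ T := fun ht => isOpen_ne.mem_nhds ht
  have h1 : ∀ {s}, s ≠ T → HasDerivAt ω (ω₀ * T / (T - s) ^ 2) s := fun hs => by
    rw [hω]; exact hasDerivAt_div_const_sub _ T hs
  have h2 : ∀ {s}, s ≠ T → HasDerivAt (deriv ω) (2 * (ω₀ * T) / (T - s) ^ 3) s := fun hs => by
    have h := hasDerivAt_div_const_sub_pow (ω₀ * T) T 2 hs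
    refine HasDerivAt.congr_of_eventuallyEq (mod_cast h) ?_
    filter_upwards [hev hs] with r hr using (h1 hr).deriv
  refine ⟨fun t ht => ?_, fun t ht => ⟨(h1 ht.2.ne).differentiableAt,
    (h2 ht.2.ne).differentiableAt⟩, ?_, fun t ht => ?_⟩
  · rw [hωt]
    exact div_pos (mul_pos hpos hT) (sub_pos.mpr ht.2)
  · refine ContinuousOn.congr (f := fun s => 2 * (ω₀ * T) / (T - s) ^ 3) ?_
      fun s hs => (h2 hs.2.ne).deriv
    exact continuousOn_const.div (by fun_prop)
      fun s hs => pow_ne_zero _ (sub_pos.mpr hs.2).ne'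
  · have htT : t ≠ T := ht.2.ne
    have hlog : ∀ {s}, s ≠ T → deriv ω s / (2 * ω s) = 1 / 2 / (T - s) := fun {s} hs => by
      have hs' : T - s ≠ 0 := sub_ne_zero.mpr hs.symm
      rw [(h1 hs).deriv, hωt]
      field_simp
    have hlog' : deriv (fun s => deriv ω s / (2 * ω s)) t = 1 / 2 / (T - t) ^ 2 := by
      refine ((hasDerivAt_div_const_sub (1 / 2) T htT).congr_of_eventuallyEq ?_).deriv
      filter_upwards [hev htT] with r hr using hlog hr
    have ha' : deriv a t = a₀ * T / (T - t) ^ 2 - a₁ / T := by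
      rw [ha]
      have hlin : HasDerivAt (fun t : ℝ => a₁ / T * t) (a₁ / T) t := by
        simpa using (hasDerivAt_id t).const_mul (a₁ / T)
      exact ((hasDerivAt_div_const_sub (a₀ * T) T htT).sub hlin).deriv
    have ht' : T - t ≠ 0 := sub_ne_zero.mpr htT.symm
    rw [hlog', hlog htT, ha', hωt, ha, hbdef, div_pow, mul_pow, hsq]
    field_simp
    ring
end

section
/- Let T, a₀, b₀ > 0 and a₁ ∈ ℝ with b₀ > (a₀/2 + 1/(2T))², set ω₀ := √(b₀ − (a₀/2 + 1/(2T))²), and define on [0,T): a(t) := a₀·T/(T−t) − (a₁/T)·t and b(t) := b₀·T²/(T−t)² + a₁²·t²/(4T²) − a₁·a₀·t/(2(T−t)) − a₁/(2T). Then for any φ, ψ ∈ ℝ the function v(t) := [φ·cos(ω₀·T·log(1 − t/T)) − (ψ + (a₀/2 + 1/(2T))·φ)·sin(ω₀·T·log(1 − t/T))/ω₀]·(1 − t/T)^{(1 + a₀·T)/2}·exp(a₁·t²/(4T)) is twice differentiable on (0,T) and satisfies v'' + a·v' + b·v = 0 on (0,T), with v(0) = φ and v'(0) = ψ. -/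
/-- The oscillation with amplitudes `A`, `B`, phase `k·log(1 − t/T)` and relaxation function
`(1 − t/T)^p·exp(c·t²/(4T))`. -/
noncomputable def logOscillation (T k p c A B t : ℝ) : ℝ :=
  (A * Real.cos (k * Real.log (1 - t / T)) + B * Real.sin (k * Real.log (1 - t / T)))
    * (1 - t / T) ^ p * Real.exp (c * t ^ 2 / (4 * T))

theorem hasDerivAt_logOscillation {T t : ℝ} (k p c A B : ℝ) (hT : 0 < T) (ht : t < T) :
    HasDerivAt (logOscillation T k p c A B)
      (-(k / (T - t)) * logOscillation T k p c B (-A) t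
        - (p / (T - t) - c * t / (2 * T)) * logOscillation T k p c A B t) t := by
  have hTt : T - t ≠ 0 := (sub_pos.2 ht).ne'
  have hpos : 0 < 1 - t / T := sub_pos.2 ((div_lt_one hT).2 ht)
  have hx : 1 - t / T = (T - t) / T := by field_simp
  have hlin : HasDerivAt (fun s : ℝ => 1 - s / T) (-(1 / T)) t :=
    ((hasDerivAt_id t).div_const T).const_sub 1
  have hphase : HasDerivAt (fun s : ℝ => k * Real.log (1 - s / T)) (-(k / (T - t))) t := by
    refine ((hlin.log hpos.ne').const_mul k).congr_deriv ?_
    rw [hx]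
    field_simp
  have hpow : HasDerivAt (fun s : ℝ => (1 - s / T) ^ p) (-(p / (T - t)) * (1 - t / T) ^ p) t := by
    refine (hlin.rpow_const (p := p) (Or.inl hpos.ne')).congr_deriv ?_
    rw [Real.rpow_sub_one hpos.ne']
    generalize (1 - t / T) ^ p = r
    rw [hx]
    field_simp
  have hexp : HasDerivAt (fun s : ℝ => Real.exp (c * s ^ 2 / (4 * T)))
      (Real.exp (c * t ^ 2 / (4 * T)) * (c * t / (2 * T))) t := by
    refine ((((hasDerivAt_id t).pow 2).const_mul c).div_const (4 * T)).exp.congr_deriv ?_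
    simp only [id, Pi.pow_apply]
    field_simp
    ring
  refine ((((hphase.cos.const_mul A).add (hphase.sin.const_mul B)).mul hpow).mul hexp).congr_deriv ?_
  simp only [logOscillation, Pi.add_apply, Pi.mul_apply]
  ring

/-- The explicit weakly dissipative oscillation with finite stopping time `T`:
with `a(t) := a₀T/(T−t) − (a₁/T)t`, the explicit `b` below, and
`ω₀ := √(b₀ − (a₀/2 + 1/(2T))²)`, the function
`v(t) := [φ·cos(ω₀T·log(1−t/T)) − (ψ + (a₀/2 + 1/(2T))·φ)·sin(ω₀T·log(1−t/T))/ω₀]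
  ·(1−t/T)^((1+a₀T)/2)·exp(a₁t²/(4T))`
is twice differentiable on `(0,T)`, solves `v'' + a v' + b v = 0` there, and satisfies
`v(0) = φ`, `v'(0) = ψ`. -/
theorem stmt_9 (T a₀ b₀ a₁ : ℝ) (hT : 0 < T) (ha₀ : 0 < a₀) (hb₀ : 0 < b₀)
    (hb₀big : (a₀ / 2 + 1 / (2 * T)) ^ 2 < b₀)
    (ω₀ : ℝ) (hω₀ : ω₀ = Real.sqrt (b₀ - (a₀ / 2 + 1 / (2 * T)) ^ 2))
    (a b : ℝ → ℝ)
    (ha : a = fun t => a₀ * T / (T - t) - a₁ / T * t)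
    (hbdef : b = fun t => b₀ * T ^ 2 / (T - t) ^ 2 + a₁ ^ 2 * t ^ 2 / (4 * T ^ 2)
        - a₁ * a₀ * t / (2 * (T - t)) - a₁ / (2 * T))
    (φ ψ : ℝ) (v : ℝ → ℝ)
    (hv : v = fun t => (φ * Real.cos (ω₀ * T * Real.log (1 - t / T))
        - (ψ + (a₀ / 2 + 1 / (2 * T)) * φ) * Real.sin (ω₀ * T * Real.log (1 - t / T)) / ω₀)
        * (1 - t / T) ^ ((1 + a₀ * T) / 2) * Real.exp (a₁ * t ^ 2 / (4 * T))) :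
    (∀ t ∈ Set.Ioo (0 : ℝ) T,
        DifferentiableAt ℝ v t ∧ DifferentiableAt ℝ (deriv v) t) ∧
    (∀ t ∈ Set.Ioo (0 : ℝ) T,
        deriv (deriv v) t + a t * deriv v t + b t * v t = 0) ∧
    v 0 = φ ∧ deriv v 0 = ψ := by
  have hω₀sq : ω₀ ^ 2 = b₀ - (a₀ / 2 + 1 / (2 * T)) ^ 2 := by
    rw [hω₀, Real.sq_sqrt (sub_pos.2 hb₀big).le]
  have hω₀pos : ω₀ ≠ 0 := by
    rw [hω₀]
    exact (Real.sqrt_pos.2 (sub_pos.2 hb₀big)).ne'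
  let u := logOscillation T (ω₀ * T) ((1 + a₀ * T) / 2) a₁
  let C := -((ψ + (a₀ / 2 + 1 / (2 * T)) * φ) / ω₀)
  let α : ℝ → ℝ := fun t => (1 + a₀ * T) / 2 / (T - t) - a₁ * t / (2 * T)
  have hvu : v = u φ C := by
    rw [hv]
    funext t
    simp only [u, C, logOscillation]
    ring
  have hu (A B t : ℝ) (ht : t < T) :
      HasDerivAt (u A B) (-(ω₀ * T / (T - t)) * u B (-A) t - α t * u A B t) t :=
    hasDerivAt_logOscillation _ _ _ A B hT ht
  have hderiv (t : ℝ) (ht : t < T) :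
      deriv v t = -(ω₀ * T / (T - t)) * u C (-φ) t - α t * u φ C t := by
    rw [hvu]
    exact (hu φ C t ht).deriv
  have hderiv2 (t : ℝ) (ht : t < T) :
      HasDerivAt (deriv v) (-(a t * deriv v t + b t * v t)) t := by
    have hTt : T - t ≠ 0 := (sub_pos.2 ht).ne'
    have hinv (q : ℝ) : HasDerivAt (fun s => q / (T - s)) (q / (T - t) ^ 2) t := by
      refine ((((hasDerivAt_id t).const_sub T).inv hTt).const_mul q).congr_deriv ?_
      simp only [id]
      ring
    have hα : HasDerivAt α ((1 + a₀ * T) / 2 / (T - t) ^ 2 - a₁ / (2 * T)) t := by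
      refine ((hinv ((1 + a₀ * T) / 2)).sub
        (((hasDerivAt_id t).const_mul a₁).div_const (2 * T))).congr_deriv ?_
      ring
    have hev : deriv v =ᶠ[nhds t]
        fun s => -(ω₀ * T / (T - s)) * u C (-φ) s - α s * u φ C s := by
      filter_upwards [Iio_mem_nhds ht] with s hs using hderiv s hs
    refine HasDerivAt.congr_of_eventuallyEq ?_ hev
    refine (((hinv (ω₀ * T)).neg.mul (hu C (-φ) t ht)).sub (hα.mul (hu φ C t ht))).congr_deriv ?_
    have hneg : u (-φ) (-C) t = -u φ C t := by
      simp only [u, logOscillation]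
      ring
    have hb₀eq : b₀ = ω₀ ^ 2 + (a₀ / 2 + 1 / (2 * T)) ^ 2 := by linarith
    rw [hderiv t ht, hneg, hvu, ha, hbdef, hb₀eq]
    simp only [α, Pi.neg_apply]
    generalize u C (-φ) t = y
    generalize u φ C t = x
    field_simp
    ring
  refine ⟨fun t ht => ⟨?_, (hderiv2 t ht.2).differentiableAt⟩, fun t ht => ?_, ?_, ?_⟩
  · rw [hvu]
    exact (hu φ C t ht.2).differentiableAt
  · rw [(hderiv2 t ht.2).deriv]
    ring
  · simp [hv]
  · rw [hderiv 0 hT]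
    simp only [u, α, C, logOscillation]
    simp only [zero_div, sub_zero, Real.log_one, mul_zero, Real.cos_zero, Real.sin_zero,
      Real.one_rpow, ne_eq, OfNat.ofNat_ne_zero, not_false_eq_true, zero_pow, Real.exp_zero]
    field_simp
    ring
end

section
/- Let T, a₀, b₀ > 0, n ∈ ℕ with n ≥ 2, and a₁ ∈ ℝ, and assume b₀ > a₀²/4; set ω₀ := √(b₀ − a₀²/4). Define on [0,T): a(t) := a₀·Tⁿ/(T−t)ⁿ − (a₁/T)·t, ω(t) := ω₀·Tⁿ/(T−t)ⁿ, and b(t) := b₀·T^{2n}/(T−t)^{2n} + n·a₀·Tⁿ/(2(T−t)^{n+1}) + n·(2−n)/(4(T−t)²) − a₁·a₀·T^{n−1}·t/(2(T−t)ⁿ) + a₁²·t²/(4T²) − a₁/(2T). Then ω is positive, twice continuously differentiable, and satisfies the frequency-function identity ω² − (ω'/(2ω))² + (ω'/(2ω))' = b − (a/2)² − a'/2 on (0,T). -/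
theorem hasDerivAt_const_div_sub_pow (c T : ℝ) (n : ℕ) {t : ℝ} (ht : t ≠ T) :
    HasDerivAt (fun s => c / (T - s) ^ n) (n * c / (T - t) ^ (n + 1)) t := by
  have hne : T - t ≠ 0 := sub_ne_zero.mpr ht.symm
  have h := (hasDerivAt_const t c).div (((hasDerivAt_id t).const_sub T).pow n) (pow_ne_zero n hne)
  refine h.congr_deriv ?_
  cases n with
  | zero => simp
  | succ k =>
    simp only [id, Pi.pow_apply, Nat.add_sub_cancel]
    field_simp
    ring

theorem deriv_const_div_sub_pow_eventuallyEq (c T : ℝ) (n : ℕ) {t : ℝ} (ht : t ≠ T) :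
    deriv (fun s => c / (T - s) ^ n) =ᶠ[nhds t] fun s => n * c / (T - s) ^ (n + 1) := by
  filter_upwards [isOpen_ne.mem_nhds ht] with s hs
  exact (hasDerivAt_const_div_sub_pow c T n hs).deriv

/-- Generalization of the finite-stopping-time example: for `n ≥ 2`, with
`a(t) := a₀Tⁿ/(T−t)ⁿ − (a₁/T)t`, `ω(t) := ω₀Tⁿ/(T−t)ⁿ` where `ω₀ := √(b₀ − a₀²/4)`,
and the explicit `b` below, the function `ω` is positive, twice continuously
differentiable on `[0,T)`, and satisfies the frequency-function identity
`ω² − (ω'/(2ω))² + (ω'/(2ω))' = b − (a/2)² − a'/2` on `(0,T)`. -/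
theorem stmt_10 (T a₀ b₀ a₁ : ℝ) (n : ℕ) (hT : 0 < T) (ha₀ : 0 < a₀) (hb₀ : 0 < b₀)
    (hn : 2 ≤ n) (hb₀big : a₀ ^ 2 / 4 < b₀)
    (ω₀ : ℝ) (hω₀ : ω₀ = Real.sqrt (b₀ - a₀ ^ 2 / 4))
    (a b ω : ℝ → ℝ)
    (ha : a = fun t => a₀ * T ^ n / (T - t) ^ n - a₁ / T * t)
    (hω : ω = fun t => ω₀ * T ^ n / (T - t) ^ n)
    (hbdef : b = fun t => b₀ * T ^ (2 * n) / (T - t) ^ (2 * n)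
        + n * a₀ * T ^ n / (2 * (T - t) ^ (n + 1))
        + n * (2 - (n : ℝ)) / (4 * (T - t) ^ 2)
        - a₁ * a₀ * T ^ (n - 1) * t / (2 * (T - t) ^ n)
        + a₁ ^ 2 * t ^ 2 / (4 * T ^ 2)
        - a₁ / (2 * T)) :
    (∀ t ∈ Set.Ico (0 : ℝ) T, 0 < ω t) ∧
    (∀ t ∈ Set.Ico (0 : ℝ) T, DifferentiableAt ℝ ω t ∧ DifferentiableAt ℝ (deriv ω) t) ∧
    ContinuousOn (deriv (deriv ω)) (Set.Ico (0 : ℝ) T) ∧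
    (∀ t ∈ Set.Ioo (0 : ℝ) T,
      ω t ^ 2 - (deriv ω t / (2 * ω t)) ^ 2 + deriv (fun s => deriv ω s / (2 * ω s)) t
        = b t - (a t / 2) ^ 2 - deriv a t / 2) := by
  have hω₀pos : 0 < ω₀ := hω₀ ▸ Real.sqrt_pos.mpr (by linarith)
  have hω₀sq : ω₀ ^ 2 = b₀ - a₀ ^ 2 / 4 := by rw [hω₀, Real.sq_sqrt (by linarith)]
  have hpos : ∀ t < T, 0 < ω t := fun t ht => by
    have : 0 < T - t := sub_pos.mpr ht
    rw [hω]
    positivity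
  have hd1 : ∀ t < T, deriv ω =ᶠ[nhds t] fun s => n * (ω₀ * T ^ n) / (T - s) ^ (n + 1) :=
    fun t ht => hω ▸ deriv_const_div_sub_pow_eventuallyEq _ T n ht.ne
  have hd2 : ∀ t < T, HasDerivAt (deriv ω)
      ((n + 1 : ℕ) * (n * (ω₀ * T ^ n)) / (T - t) ^ (n + 1 + 1)) t := fun t ht =>
    (hasDerivAt_const_div_sub_pow _ T (n + 1) ht.ne).congr_of_eventuallyEq (hd1 t ht)
  refine ⟨fun t ht => hpos t ht.2, fun t ht => ⟨?_, (hd2 t ht.2).differentiableAt⟩, ?_, ?_⟩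
  · rw [hω]
    exact (hasDerivAt_const_div_sub_pow _ T n ht.2.ne).differentiableAt
  · refine ContinuousOn.congr (fun t ht => ?_) fun t ht => (hd2 t ht.2).deriv
    exact (hasDerivAt_const_div_sub_pow _ T (n + 1 + 1)
      ht.2.ne).continuousAt.continuousWithinAt
  · rintro t ⟨-, ht⟩
    have hq : ∀ s < T, deriv ω s / (2 * ω s) = n / 2 / (T - s) ^ 1 := fun s hs => by
      have hs' : T - s ≠ 0 := (sub_pos.mpr hs).ne'
      rw [(hd1 s hs).eq_of_nhds, hω]
      field_simp
      ring
    have hdq : deriv (fun s => deriv ω s / (2 * ω s)) t = n / 2 / (T - t) ^ 2 := by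
      have h : (fun s => deriv ω s / (2 * ω s)) =ᶠ[nhds t] fun s => n / 2 / (T - s) ^ 1 := by
        filter_upwards [isOpen_Iio.mem_nhds ht] with s hs using hq s hs
      rw [h.deriv_eq, (hasDerivAt_const_div_sub_pow _ T 1 ht.ne).deriv]
      simp
    have hda : deriv a t = n * (a₀ * T ^ n) / (T - t) ^ (n + 1) - a₁ / T := by
      rw [ha]
      refine HasDerivAt.deriv ?_
      refine (hasDerivAt_const_div_sub_pow (a₀ * T ^ n) T n ht.ne).fun_sub ?_
      simpa using (hasDerivAt_id t).const_mul (a₁ / T)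
    rw [hdq, hda, hq t ht, ha, hω, hbdef]
    obtain ⟨k, rfl⟩ : ∃ k, n = k + 1 := ⟨n - 1, by omega⟩
    have ht' : T - t ≠ 0 := (sub_pos.mpr ht).ne'
    have hb : b₀ = ω₀ ^ 2 + a₀ ^ 2 / 4 := by linarith
    simp only [hb, Nat.add_sub_cancel]
    generalize T - t = u at ht' ⊢
    field_simp
    ring
end

section
/- Let K : ℝ → ℝ be integrable, with K(t) = 0 for t ≤ 0, K(t) > 0 for t > 0, and K strictly decreasing on (0,∞). Then for every ω > 0 the sine transform is strictly positive: ∫₀^∞ K(t)·sin(2πωt) dt > 0. -/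
open MeasureTheory

/-- A function weighted by a sine has positive integral over each full period contained in the
half-line where the function is strictly decreasing. -/
lemma intervalIntegral_mul_sin_period_pos (K : ℝ → ℝ) (hint : Integrable K)
    (hanti : StrictAntiOn K (Set.Ioi 0)) {ω h : ℝ} (hh : 0 < h) (hωh : 2 * ω * h = 1) (n : ℕ) :
    0 < ∫ t in (2 * n * h)..(2 * (n + 1 : ℕ) * h), K t * Real.sin (2 * Real.pi * ω * t) := by
  have hω : 0 < ω := by
    by_contra! hle
    nlinarith
  have hf : Integrable fun t => K t * Real.sin (2 * Real.pi * ω * t) :=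
    hint.mul_bdd (c := 1) (by fun_prop) (.of_forall fun t => by
      simpa using Real.abs_sin_le_one _)
  set a : ℝ := 2 * n * h with ha
  have ha0 : 0 ≤ a := by positivity
  have hb : 2 * ((n + 1 : ℕ) : ℝ) * h = a + h + h := by push_cast; ring
  have hshift := intervalIntegral.integral_comp_add_right (a := a) (b := a + h)
    (fun t => K t * Real.sin (2 * Real.pi * ω * t)) h
  rw [hb, ← intervalIntegral.integral_add_adjacent_intervals (b := a + h)
    hf.intervalIntegrable hf.intervalIntegrable, ← hshift,
    ← intervalIntegral.integral_add hf.intervalIntegrable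
      (hf.comp_add_right h).intervalIntegrable]
  refine intervalIntegral.intervalIntegral_pos_of_pos_on
    (hf.add (hf.comp_add_right h)).intervalIntegrable (fun t ht => ?_) (by linarith)
  have htpos : 0 < t := ha0.trans_lt ht.1
  have hK : K (t + h) < K t := hanti htpos (by simp; linarith) (by linarith)
  have hsin_shift : Real.sin (2 * Real.pi * ω * (t + h)) = -Real.sin (2 * Real.pi * ω * t) := by
    rw [← Real.sin_add_pi]
    congr 1
    linear_combination Real.pi * hωh
  have hphase : 2 * Real.pi * ω * t - n * (2 * Real.pi) = 2 * Real.pi * ω * (t - a) := by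
    rw [ha]
    linear_combination 2 * Real.pi * n * hωh
  have hsin : 0 < Real.sin (2 * Real.pi * ω * t) := by
    rw [← Real.sin_sub_nat_mul_two_pi _ n, hphase]
    have hc : 0 < 2 * Real.pi * ω := by positivity
    refine Real.sin_pos_of_pos_of_lt_pi (mul_pos hc (by linarith [ht.1])) ?_
    calc 2 * Real.pi * ω * (t - a) < 2 * Real.pi * ω * h :=
          mul_lt_mul_of_pos_left (by linarith [ht.2]) hc
      _ = Real.pi := by linear_combination Real.pi * hωh
  rw [hsin_shift]
  nlinarith [mul_pos (sub_pos.2 hK) hsin]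

/-- For an integrable relaxation function `K` (vanishing on `(−∞,0]`,
positive and strictly decreasing on `(0,∞)`), the sine transform is strictly positive
for every positive frequency: `∫₀^∞ K(t)·sin(2πωt) dt > 0` for all `ω > 0`. -/
theorem stmt_11 (K : ℝ → ℝ) (hint : Integrable K)
    (h0 : ∀ t : ℝ, t ≤ 0 → K t = 0)
    (hpos : ∀ t : ℝ, 0 < t → 0 < K t)
    (hanti : StrictAntiOn K (Set.Ioi 0)) :
    ∀ ω : ℝ, 0 < ω →
      0 < ∫ t in Set.Ioi (0 : ℝ), K t * Real.sin (2 * Real.pi * ω * t) := by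
  intro ω hω
  obtain ⟨h, hh, hωh⟩ : ∃ h : ℝ, 0 < h ∧ 2 * ω * h = 1 :=
    ⟨(2 * ω)⁻¹, by positivity, mul_inv_cancel₀ (by positivity)⟩
  have hf : Integrable fun t => K t * Real.sin (2 * Real.pi * ω * t) :=
    hint.mul_bdd (c := 1) (by fun_prop) (.of_forall fun t => by
      simpa using Real.abs_sin_le_one _)
  set F : ℕ → ℝ := fun n => ∫ t in (0 : ℝ)..(2 * n * h), K t * Real.sin (2 * Real.pi * ω * t)
    with hF
  have hstep (n : ℕ) : F n < F (n + 1) := by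
    have hadd := intervalIntegral.integral_add_adjacent_intervals (a := 0) (b := 2 * n * h)
      (c := 2 * (n + 1 : ℕ) * h) (hf.intervalIntegrable (μ := volume)) hf.intervalIntegrable
    have hperiod := intervalIntegral_mul_sin_period_pos K hint hanti hh hωh n
    simp only [hF]
    linarith
  have hmono : StrictMono F := strictMono_nat_of_lt_succ hstep
  have hlim : Filter.Tendsto (fun n : ℕ => 2 * (n : ℝ) * h) Filter.atTop Filter.atTop :=
    (tendsto_natCast_atTop_atTop.const_mul_atTop two_pos).atTop_mul_const hh
  have htend := intervalIntegral_tendsto_integral_Ioi 0 hf.integrableOn hlim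
  calc 0 = F 0 := by simp [hF]
    _ < F 1 := hmono one_pos
    _ ≤ _ := hmono.monotone.ge_of_tendsto htend 1
end

section
/- Let K : ℝ → ℝ be integrable, with K(t) = 0 for t ≤ 0, K(t) > 0 for t > 0, K strictly decreasing on (0,∞), and ∫_ℝ |K(t)| dt ≤ 1/√2. Then there exists a dissipation law α : ℝ → ℂ, i.e., a function with Re(α) nonnegative and even and Im(α) odd, such that ∫_ℝ K(t)·e^{2πiωt} dt = exp(−α(ω)) for every ω ∈ ℝ. -/
open MeasureTheory

/-- An integrable real function stays integrable when multiplied by a Fourier phase. -/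
theorem integrable_ofReal_mul_exp {K : ℝ → ℝ} (hint : Integrable K) (ω : ℝ) :
    Integrable fun t : ℝ =>
      (K t : ℂ) * Complex.exp ((2 * Real.pi * ω * t : ℝ) * Complex.I) := by
  refine hint.ofReal.mul_bdd (c := 1) (by fun_prop) (Filter.Eventually.of_forall fun t => ?_)
  rw [Complex.norm_exp_ofReal_mul_I]

/-- The sine transform of a relaxation function is positive at positive frequencies: the
half-periods on which the sine is negative are translated onto those on which it is positive. -/
theorem integral_mul_sin_pos {K : ℝ → ℝ} (hint : Integrable K)
    (h0 : ∀ t : ℝ, t ≤ 0 → K t = 0)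
    (hanti : StrictAntiOn K (Set.Ioi 0)) {ω : ℝ} (hω : 0 < ω) :
    0 < ∫ t : ℝ, K t * Real.sin (2 * Real.pi * ω * t) := by
  set h : ℝ := 1 / (2 * ω) with hh
  have h_pos : 0 < h := by positivity
  have hωh : 2 * Real.pi * ω * h = Real.pi := by rw [hh]; field_simp
  set p : ℝ → ℝ := fun t => max (Real.sin (2 * Real.pi * ω * t)) 0 with hp
  have hp_meas : Continuous p := by fun_prop
  have hp_nonneg : ∀ t, 0 ≤ p t := fun t => le_max_right _ _
  have hp_bdd : ∀ t, ‖p t‖ ≤ 1 := fun t => by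
    rw [Real.norm_of_nonneg (hp_nonneg t)]
    exact max_le (Real.sin_le_one _) zero_le_one
  have hp_int : ∀ {f : ℝ → ℝ}, Integrable f → ∀ a : ℝ, Integrable fun t => f t * p (t + a) :=
    fun hf a => hf.mul_bdd (c := 1) (by fun_prop)
      (Filter.Eventually.of_forall fun t => hp_bdd (t + a))
  have hp_int₀ : ∀ {f : ℝ → ℝ}, Integrable f → Integrable fun t => f t * p t :=
    fun hf => by simpa using hp_int hf 0
  have hshift : Integrable fun t => K (t + h) := hint.comp_add_right h
  have hsin : ∀ t, Real.sin (2 * Real.pi * ω * t) = p t - p (t + -h) := fun t => by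
    have : 2 * Real.pi * ω * (t + -h) = 2 * Real.pi * ω * t - Real.pi := by
      linear_combination -hωh
    simp only [hp, this, Real.sin_sub_pi]
    rcases le_total 0 (Real.sin (2 * Real.pi * ω * t)) with hs | hs
    · rw [max_eq_left hs, max_eq_right (by linarith)]; ring
    · rw [max_eq_right hs, max_eq_left (by linarith)]; ring
  have htrans : ∫ t, K t * p (t + -h) = ∫ t, K (t + h) * p t := by
    rw [← integral_add_right_eq_self (fun t => K t * p (t + -h)) h]
    simp
  have hkey : ∫ t, K t * Real.sin (2 * Real.pi * ω * t) = ∫ t, (K t - K (t + h)) * p t := by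
    simp_rw [hsin, mul_sub, sub_mul]
    rw [integral_sub (hp_int₀ hint) (hp_int hint _), htrans,
      integral_sub (hp_int₀ hint) (hp_int₀ hshift)]
  have hdiff : ∀ t, 0 < t → 0 < K t - K (t + h) := fun t ht =>
    sub_pos.2 (hanti ht (show 0 < t + h by linarith) (by linarith))
  have hnonneg : ∀ t, 0 ≤ (K t - K (t + h)) * p t := fun t => by
    rcases lt_or_ge 0 t with ht | ht
    · exact mul_nonneg (hdiff t ht).le (hp_nonneg t)
    rcases le_or_gt t (-h) with hth | hth
    · rw [h0 t ht, h0 (t + h) (by linarith)]; simp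
    · have : p t = 0 := max_eq_right <| Real.sin_nonpos_of_nonpos_of_neg_pi_le
        (mul_nonpos_of_nonneg_of_nonpos (by positivity) ht) (by
          have := mul_le_mul_of_nonneg_left hth.le (by positivity : 0 ≤ 2 * Real.pi * ω)
          rwa [mul_neg, hωh] at this)
      simp [this]
  rw [hkey, integral_pos_iff_support_of_nonneg hnonneg (hp_int₀ (hint.sub hshift))]
  have hsub : Set.Ioo 0 h ⊆ Function.support fun t => (K t - K (t + h)) * p t := fun t ht => by
    refine (mul_pos (hdiff t ht.1) (lt_max_of_lt_left ?_)).ne'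
    refine Real.sin_pos_of_pos_of_lt_pi (by have := ht.1; positivity) ?_
    exact (mul_lt_mul_of_pos_left ht.2 (by positivity)).trans_eq hωh
  refine lt_of_lt_of_le ?_ (measure_mono hsub)
  simpa using h_pos

/-- The Fourier transform of a relaxation function avoids the closed negative real axis. -/
theorem fourier_relaxation_mem_slitPlane {K : ℝ → ℝ} (hint : Integrable K)
    (h0 : ∀ t : ℝ, t ≤ 0 → K t = 0) (hpos : ∀ t : ℝ, 0 < t → 0 < K t)
    (hanti : StrictAntiOn K (Set.Ioi 0)) (ω : ℝ) :
    (∫ t : ℝ, (K t : ℂ) * Complex.exp ((2 * Real.pi * ω * t : ℝ) * Complex.I))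
      ∈ Complex.slitPlane := by
  have him : (∫ t : ℝ, (K t : ℂ) * Complex.exp ((2 * Real.pi * ω * t : ℝ) * Complex.I)).im
      = ∫ t : ℝ, K t * Real.sin (2 * Real.pi * ω * t) := by
    refine (integral_im (integrable_ofReal_mul_exp hint ω)).symm.trans
      (integral_congr_ae (Filter.Eventually.of_forall fun t => ?_))
    change (_ : ℂ).im = _
    rw [Complex.im_ofReal_mul, Complex.exp_ofReal_mul_I_im]
  rw [Complex.mem_slitPlane_iff]
  rcases lt_trichotomy ω 0 with hω | rfl | hω
  · right
    have hneg := integral_mul_sin_pos hint h0 hanti (neg_pos.2 hω)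
    simp only [mul_neg, neg_mul, Real.sin_neg, integral_neg] at hneg
    rw [him]
    linarith
  · left
    have hnonneg : ∀ t, 0 ≤ K t := fun t =>
      (le_or_gt t 0).elim (fun ht => (h0 t ht).ge) fun ht => (hpos t ht).le
    have hKpos : 0 < ∫ t, K t := by
      rw [integral_pos_iff_support_of_nonneg hnonneg hint]
      refine lt_of_lt_of_le ?_ (measure_mono fun t (ht : t ∈ Set.Ioi 0) => (hpos t ht).ne')
      simp
    simpa [integral_complex_ofReal] using hKpos
  · right
    rw [him]
    exact (integral_mul_sin_pos hint h0 hanti hω).ne'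

/-- For an integrable relaxation function `K` (vanishing on `(−∞,0]`,
positive and strictly decreasing on `(0,∞)`) with `∫|K| ≤ 1/√2`, there exists a
dissipation law `α : ℝ → ℂ` (real part nonnegative and even, imaginary part odd) with
`∫ K(t)·e^{2πiωt} dt = exp(−α(ω))` for every `ω ∈ ℝ`. -/
theorem stmt_14 (K : ℝ → ℝ) (hint : Integrable K)
    (h0 : ∀ t : ℝ, t ≤ 0 → K t = 0)
    (hpos : ∀ t : ℝ, 0 < t → 0 < K t)
    (hanti : StrictAntiOn K (Set.Ioi 0))
    (hnorm : (∫ t : ℝ, |K t|) ≤ 1 / Real.sqrt 2) :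
    ∃ α : ℝ → ℂ,
      (∀ ω : ℝ, 0 ≤ (α ω).re) ∧
      (∀ ω : ℝ, (α (-ω)).re = (α ω).re) ∧
      (∀ ω : ℝ, (α (-ω)).im = -(α ω).im) ∧
      (∀ ω : ℝ,
        (∫ t : ℝ, (K t : ℂ) * Complex.exp ((2 * Real.pi * ω * t : ℝ) * Complex.I))
          = Complex.exp (-α ω)) := by
  set F : ℝ → ℂ := fun ω =>
    ∫ t : ℝ, (K t : ℂ) * Complex.exp ((2 * Real.pi * ω * t : ℝ) * Complex.I) with hF
  have hslit : ∀ ω, F ω ∈ Complex.slitPlane :=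
    fourier_relaxation_mem_slitPlane hint h0 hpos hanti
  have hlog : ∀ ω, Complex.log (F (-ω)) = (starRingEnd ℂ) (Complex.log (F ω)) := fun ω => by
    rw [← Complex.log_conj _ (Complex.slitPlane_arg_ne_pi (hslit ω))]
    congr 1
    simp only [hF]
    rw [← integral_conj]
    refine integral_congr_ae (Filter.Eventually.of_forall fun t => ?_)
    simp only [map_mul, Complex.conj_ofReal, ← Complex.exp_conj, Complex.conj_I]
    push_cast
    ring_nf
  have hle : ∀ ω, ‖F ω‖ ≤ 1 := fun ω => by
    refine (norm_integral_le_integral_norm _).trans ?_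
    simp only [norm_mul, Complex.norm_exp_ofReal_mul_I, mul_one, Complex.norm_real,
      Real.norm_eq_abs]
    refine hnorm.trans ((div_le_one (by positivity)).2 ?_)
    exact Real.one_le_sqrt.2 one_le_two
  refine ⟨fun ω => -Complex.log (F ω), fun ω => ?_, fun ω => ?_, fun ω => ?_, fun ω => ?_⟩
  · rw [Complex.neg_re, Complex.log_re, neg_nonneg]
    exact Real.log_nonpos (norm_nonneg _) (hle ω)
  · simp only [hlog, Complex.neg_re, Complex.conj_re]
  · simp only [hlog, Complex.neg_im, Complex.conj_im]
  · rw [neg_neg, Complex.exp_log (Complex.slitPlane_ne_zero (hslit ω))]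
end
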